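/- For every a ∈ ℝ and all integers l, k ≥ 1, one has (M(a; l, k) ⊎ M(a; l, k))^# = M(a; k, l) ⊎ M(a; k, l), where ⊎ denotes multiset union. (This is the combinatorial content, via the Moeglin–Waldspurger algorithm, of the statement that the dual of the Langlands quotient of u(Z(ρ,l),k) × u(Z(ρ,l),k) is the Langlands quotient of u(Z(ρ,k),l) × u(Z(ρ,k),l).) -/

import Mathlib

open scoped Classical

noncomputable section

/-- The segment `{a, a+1, ..., a+m-1}` as a finite set of reals. -/
def finsetSeg (a : ℝ) (m : ℕ) : Finset ℝ :=
  (Finset.range m).image (fun i => a + i)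

/-- A segment is a nonempty subset of `ℝ` of the form `{a, a+1, ..., a+m-1}` with `m ≥ 1`. -/
def IsSegment (S : Finset ℝ) : Prop :=
  ∃ (a : ℝ) (m : ℕ), 1 ≤ m ∧ S = finsetSeg a m

/-- A multisegment is a nonempty finite multiset of segments. -/
def IsMultisegment (M : Multiset (Finset ℝ)) : Prop :=
  M ≠ 0 ∧ ∀ S ∈ M, IsSegment S

/-- The beginning (smallest element) of a segment. -/
def beg (S : Finset ℝ) : ℝ := if h : S.Nonempty then S.min' h else 0

/-- The ending (largest element) of a segment. -/
def endg (S : Finset ℝ) : ℝ := if h : S.Nonempty then S.max' h else 0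

/-- Two segments are linked if neither is included in the other and their union is a segment. -/
def Linked (S₁ S₂ : Finset ℝ) : Prop :=
  ¬ S₁ ⊆ S₂ ∧ ¬ S₂ ⊆ S₁ ∧ IsSegment (S₁ ∪ S₂)

/-- `ElemOp M N` means that `N` is obtained from `M` by an elementary operation:
a pair of linked segments `S₁, S₂` of `M` is replaced by `S₁ ∪ S₂, S₁ ∩ S₂`,
the intersection being omitted when empty. -/
def ElemOp (M N : Multiset (Finset ℝ)) : Prop :=
  ∃ (S₁ S₂ : Finset ℝ) (rest : Multiset (Finset ℝ)),
    Linked S₁ S₂ ∧ M = S₁ ::ₘ S₂ ::ₘ rest ∧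
    N = (if S₁ ∩ S₂ = ∅ then (S₁ ∪ S₂) ::ₘ rest
         else (S₁ ∪ S₂) ::ₘ (S₁ ∩ S₂) ::ₘ rest)

/-- `msLE M M'` (i.e. `M ≤ M'`) : `M` is obtained from `M'` by a finite (possibly empty)
sequence of elementary operations. -/
def msLE (M M' : Multiset (Finset ℝ)) : Prop :=
  Relation.ReflTransGen ElemOp M' M

/-- The support of a multisegment: the multiset union of its segments. -/
def suppM (M : Multiset (Finset ℝ)) : Multiset ℝ :=
  (M.map Finset.val).sum

/-- The maxlength `m(M)`: the maximal length of the segments of `M`. -/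
def maxLen (M : Multiset (Finset ℝ)) : ℕ :=
  (M.map Finset.card).sup

/-- The thickness `t(M)`: the number of segments of `M`, counted with multiplicity. -/
def thickness (M : Multiset (Finset ℝ)) : ℕ := Multiset.card M

/-- The largest element of `E(M)`, the multiset of endings of the segments of `M`. -/
def maxEnd (M : Multiset (Finset ℝ)) : ℝ :=
  ((M.map endg).toFinset.max).unbotD 0

/-- The candidate segments of `M` with ending `x` which are not included in `prev`. -/
def cands (M : Multiset (Finset ℝ)) (x : ℝ) (prev : Finset ℝ) : Finset (Finset ℝ) :=
  M.toFinset.filter (fun S => endg S = x ∧ ¬ S ⊆ prev)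

/-- A shortest element of a finite collection of finite sets (junk value `∅` if empty).
In the Moeglin-Waldspurger algorithm the candidate sets consist of segments with a
common ending, so a shortest candidate is unique and this choice is canonical. -/
def chooseMin (C : Finset (Finset ℝ)) : Finset ℝ :=
  if h : C.Nonempty then (Finset.exists_min_image C Finset.card h).choose else ∅

/-- The chain `δ₀, δ₁, δ₂, ...` of the Moeglin-Waldspurger algorithm: `δ₀` is a shortest
segment of `M` with ending `x` (the maximal ending), and `δ_i` is a shortest segment of
`M` with ending `x - i` not included in `δ_{i-1}`; the construction stops when no such
segment exists.  The first argument is fuel (the chain has length at most `card M`). -/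
def mwChainAux (M : Multiset (Finset ℝ)) : ℕ → ℝ → Finset ℝ → List (Finset ℝ)
  | 0, _, _ => []
  | n + 1, x, prev =>
      if (cands M x prev).Nonempty then
        chooseMin (cands M x prev) :: mwChainAux M n (x - 1) (chooseMin (cands M x prev))
      else []

/-- The chain `δ₀, δ₁, ..., δ_r` of the Moeglin-Waldspurger algorithm for `M`. -/
def mwChain (M : Multiset (Finset ℝ)) : List (Finset ℝ) :=
  mwChainAux M (Multiset.card M) (maxEnd M) ∅

/-- The first segment `S₀ = {e-r, ..., e}` of `M^#`, where `e = maxEnd M` and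
`r + 1` is the length of the chain. -/
def firstSeg (M : Multiset (Finset ℝ)) : Finset ℝ :=
  finsetSeg (maxEnd M - (((mwChain M).length - 1 : ℕ) : ℝ)) (mwChain M).length

/-- `δ⁻`: the segment `δ` with its ending removed. -/
def segMinus (S : Finset ℝ) : Finset ℝ := S.erase (endg S)

/-- `M⁻`: the multisegment obtained from `M` by replacing each `δ_i` of the chain by
`δ_i⁻`, erasing it if it becomes empty. -/
def msMinus (M : Multiset (Finset ℝ)) : Multiset (Finset ℝ) :=
  (mwChain M).foldl
    (fun N δ => if segMinus δ = ∅ then N.erase δ else segMinus δ ::ₘ N.erase δ) M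

/-- Fuelled version of the Moeglin-Waldspurger algorithm.  Each round extracts the first
segment `S₀` and recurses on `M⁻`; on a genuine multisegment each round strictly decreases
the cardinality of the support, so fuel `card (suppM M)` always suffices. -/
def mwaAux : ℕ → Multiset (Finset ℝ) → Multiset (Finset ℝ)
  | 0, _ => 0
  | n + 1, M => if M = 0 then 0 else firstSeg M ::ₘ mwaAux n (msMinus M)

/-- The Moeglin-Waldspurger algorithm `M ↦ M^#`. -/
def mwa (M : Multiset (Finset ℝ)) : Multiset (Finset ℝ) :=
  mwaAux (Multiset.card (suppM M)) M

/-- The staircase multisegment `M(a; l, k)`: the `k` segments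
`{a+i, a+i+1, ..., a+i+l-1}` for `i = 1, ..., k` (`k` segments of length `l`,
each a shift by `1` of the previous one). -/
def staircase (a : ℝ) (l k : ℕ) : Multiset (Finset ℝ) :=
  (Multiset.range k).map (fun i => finsetSeg (a + i + 1) l)

theorem mem_finsetSeg {b x : ℝ} {m : ℕ} : x ∈ finsetSeg b m ↔ ∃ i < m, b + (i : ℝ) = x := by
  simp [finsetSeg, eq_neg_add_iff_add_eq]

theorem finsetSeg_succ (b : ℝ) (m : ℕ) :
    finsetSeg b (m + 1) = insert (b + (m : ℝ)) (finsetSeg b m) := by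
  ext x
  simp only [Finset.mem_insert, mem_finsetSeg, Nat.lt_succ_iff_lt_or_eq]
  constructor
  · rintro ⟨i, hi | rfl, rfl⟩
    · exact Or.inr ⟨i, hi, rfl⟩
    · exact Or.inl rfl
  · rintro (rfl | ⟨i, hi, rfl⟩)
    · exact ⟨m, Or.inr rfl, rfl⟩
    · exact ⟨i, Or.inl hi, rfl⟩

theorem finsetSeg_zero (b : ℝ) : finsetSeg b 0 = ∅ := by
  simp [finsetSeg]

theorem finsetSeg_succ_ne_empty (b : ℝ) (m : ℕ) : finsetSeg b (m + 1) ≠ ∅ := by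
  rw [finsetSeg_succ]
  exact Finset.insert_ne_empty _ _

theorem card_finsetSeg (b : ℝ) (m : ℕ) : (finsetSeg b m).card = m := by
  have h : finsetSeg b m = (Finset.range m).image fun i : ℕ => b + (i : ℝ) := by
    ext x
    simp only [mem_finsetSeg, Finset.mem_image, Finset.mem_range]
  rw [h, Finset.card_image_of_injective, Finset.card_range]
  intro i j hij
  simpa using hij

theorem endg_finsetSeg_succ (b : ℝ) (m : ℕ) : endg (finsetSeg b (m + 1)) = b + (m : ℝ) := by
  have h : (finsetSeg b (m + 1)).Nonempty :=
    Finset.nonempty_iff_ne_empty.mpr (finsetSeg_succ_ne_empty b m)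
  rw [endg, dif_pos h]
  refine le_antisymm (Finset.max'_le _ _ _ fun y hy => ?_)
    (Finset.le_max' _ _ (mem_finsetSeg.mpr ⟨m, m.lt_succ_self, rfl⟩))
  obtain ⟨i, hi, rfl⟩ := mem_finsetSeg.mp hy
  have : (i : ℝ) ≤ m := by exact_mod_cast Nat.lt_succ_iff.mp hi
  linarith

theorem segMinus_finsetSeg_succ (b : ℝ) (m : ℕ) :
    segMinus (finsetSeg b (m + 1)) = finsetSeg b m := by
  rw [segMinus, endg_finsetSeg_succ, finsetSeg_succ, Finset.erase_insert]
  rw [mem_finsetSeg]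
  rintro ⟨i, hi, h⟩
  have : (i : ℝ) = m := by linarith
  exact hi.ne (by exact_mod_cast this)

theorem chooseMin_singleton (S : Finset ℝ) : chooseMin {S} = S := by
  have h : ({S} : Finset (Finset ℝ)).Nonempty := Finset.singleton_nonempty S
  rw [chooseMin, dif_pos h]
  exact Finset.mem_singleton.mp (Finset.exists_min_image {S} Finset.card h).choose_spec.1

theorem maxEnd_eq_of_isGreatest {M : Multiset (Finset ℝ)} {x : ℝ}
    (hx : ∃ S ∈ M, endg S = x) (hle : ∀ S ∈ M, endg S ≤ x) : maxEnd M = x := by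
  have h : (M.map endg).toFinset.max = (x : WithBot ℝ) := by
    refine le_antisymm (Finset.max_le fun y hy => ?_) (Finset.le_max (by simpa using hx))
    obtain ⟨S, hS, rfl⟩ := Multiset.mem_map.mp (Multiset.mem_toFinset.mp hy)
    exact WithBot.coe_le_coe.mpr (hle S hS)
  rw [maxEnd, h, WithBot.unbotD_coe]

theorem card_suppM (M : Multiset (Finset ℝ)) :
    Multiset.card (suppM M) = (M.map Finset.card).sum := by
  rw [suppM]
  induction M using Multiset.induction_on with
  | empty => simp
  | cons S M ih => simp [ih]

theorem mem_staircase {a : ℝ} {l k : ℕ} {S : Finset ℝ} :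
    S ∈ staircase a l k ↔ ∃ i < k, finsetSeg (a + (i : ℝ) + 1) l = S := by
  simp [staircase]

theorem card_staircase (a : ℝ) (l k : ℕ) : Multiset.card (staircase a l k) = k := by
  simp [staircase]

theorem staircase_succ (a : ℝ) (l k : ℕ) :
    staircase a l (k + 1) = finsetSeg (a + (k : ℝ) + 1) l ::ₘ staircase a l k := by
  simp [staircase, Multiset.range_succ]

/-- The segments of `staircase a l j`, in order of decreasing endings. -/
def descList (a : ℝ) (l : ℕ) : ℕ → List (Finset ℝ)
  | 0 => []
  | j + 1 => finsetSeg (a + (j : ℝ) + 1) l :: descList a l j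

theorem coe_descList (a : ℝ) (l j : ℕ) :
    (descList a l j : Multiset (Finset ℝ)) = staircase a l j := by
  induction j with
  | zero => simp [descList, staircase]
  | succ j ih => rw [descList, staircase_succ, ← ih, Multiset.cons_coe]

theorem map_segMinus_staircase (a : ℝ) (p k : ℕ) :
    (staircase a (p + 1) k).map segMinus = staircase a p k := by
  simp only [staircase, Multiset.map_map]
  exact Multiset.map_congr rfl fun i _ => segMinus_finsetSeg_succ _ _

theorem foldl_segMinus (L : List (Finset ℝ)) (R : Multiset (Finset ℝ)) :
    L.foldl (fun N δ => if segMinus δ = ∅ then N.erase δ else segMinus δ ::ₘ N.erase δ)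
        ((L : Multiset (Finset ℝ)) + R) =
      ((L : Multiset (Finset ℝ)).map segMinus).filter (· ≠ ∅) + R := by
  induction L generalizing R with
  | nil => simp
  | cons d L ih =>
    rw [List.foldl_cons, ← Multiset.cons_coe, Multiset.cons_add, Multiset.erase_cons_head,
      Multiset.map_cons]
    by_cases h : segMinus d = ∅
    · rw [if_pos h, ih, Multiset.filter_cons_of_neg _ (by simpa using h)]
    · rw [if_neg h, ← Multiset.add_cons, ih, Multiset.filter_cons_of_pos (p := (· ≠ ∅)) _ h,
        Multiset.add_cons, Multiset.cons_add]

/-- `NearStair a p k M` says that every segment of `M` is a segment of the staircase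
`M(a; p+1, k)` or is obtained from one by removing its ending. -/
def NearStair (a : ℝ) (p k : ℕ) (M : Multiset (Finset ℝ)) : Prop :=
  ∀ S ∈ M, ∃ i < k, ∃ q, (q = p ∨ p = q + 1) ∧ S = finsetSeg (a + (i : ℝ) + 1) (q + 1)

theorem NearStair.of_mem_cands {a : ℝ} {p k j : ℕ} {M : Multiset (Finset ℝ)} {prev S : Finset ℝ}
    (hM : NearStair a p k M) (hprev : k ≤ j ∨ prev = finsetSeg (a + (j : ℝ) + 1) (p + 1))
    (hS : S ∈ cands M (a + (j : ℝ) + (p : ℝ)) prev) :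
    ∃ i, j = i + 1 ∧ S = finsetSeg (a + (i : ℝ) + 1) (p + 1) := by
  obtain ⟨hSM, hend, hsub⟩ : S ∈ M ∧ endg S = a + (j : ℝ) + (p : ℝ) ∧ ¬ S ⊆ prev := by
    simpa [cands] using hS
  obtain ⟨i, hi, q, hq, rfl⟩ := hM S hSM
  rw [endg_finsetSeg_succ] at hend
  have hij : i + 1 + q = j + p := by
    have : (i : ℝ) + 1 + q = j + p := by linarith
    exact_mod_cast this
  rcases hq with rfl | rfl
  · exact ⟨i, by omega, rfl⟩
  · obtain rfl : i = j := by omega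
    refine absurd ?_ hsub
    rcases hprev with h | rfl
    · omega
    · rw [finsetSeg_succ _ (q + 1)]
      exact Finset.subset_insert _ _

theorem NearStair.mwChainAux_eq {a : ℝ} {p k : ℕ} {M : Multiset (Finset ℝ)}
    (hM : NearStair a p k M) (hle : staircase a (p + 1) k ≤ M) {n j : ℕ} {prev : Finset ℝ}
    (hj : j ≤ k) (hn : j ≤ n)
    (hprev : prev = if j = k then ∅ else finsetSeg (a + (j : ℝ) + 1) (p + 1)) :
    mwChainAux M n (a + (j : ℝ) + (p : ℝ)) prev = descList a (p + 1) j := by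
  have hprev' : k ≤ j ∨ prev = finsetSeg (a + (j : ℝ) + 1) (p + 1) := by
    by_cases h : j = k
    · exact Or.inl h.ge
    · exact Or.inr (by rw [hprev, if_neg h])
  induction n generalizing j prev with
  | zero =>
    obtain rfl : j = 0 := by omega
    rfl
  | succ n ih =>
    cases j with
    | zero =>
      rw [mwChainAux, if_neg, descList]
      rintro ⟨S, hS⟩
      obtain ⟨i, hi, -⟩ := hM.of_mem_cands hprev' hS
      omega
    | succ j =>
      have hend : endg (finsetSeg (a + (j : ℝ) + 1) (p + 1)) =
          a + ((j + 1 : ℕ) : ℝ) + (p : ℝ) := by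
        rw [endg_finsetSeg_succ]
        push_cast
        ring
      have hc : cands M (a + ((j + 1 : ℕ) : ℝ) + (p : ℝ)) prev =
          {finsetSeg (a + (j : ℝ) + 1) (p + 1)} := by
        refine Finset.eq_singleton_iff_unique_mem.mpr ⟨?_, fun S hS => ?_⟩
        · have hmem : finsetSeg (a + (j : ℝ) + 1) (p + 1) ∈ M :=
            Multiset.mem_of_le hle (mem_staircase.mpr ⟨j, by omega, rfl⟩)
          have hnot : ¬ finsetSeg (a + (j : ℝ) + 1) (p + 1) ⊆ prev := by
            intro hsub
            have hfirst : a + (j : ℝ) + 1 ∈ prev :=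
              hsub (mem_finsetSeg.mpr ⟨0, by omega, by simp⟩)
            rw [hprev] at hfirst
            split_ifs at hfirst with h
            · simp at hfirst
            · obtain ⟨i, -, hi⟩ := mem_finsetSeg.mp hfirst
              push_cast at hi
              have : (0 : ℝ) ≤ i := i.cast_nonneg
              linarith
          simp [cands, hmem, hnot, hend]
        · obtain ⟨i, hi, rfl⟩ := hM.of_mem_cands hprev' hS
          obtain rfl : j = i := by omega
          rfl
      have hx : a + ((j + 1 : ℕ) : ℝ) + (p : ℝ) - 1 = a + (j : ℝ) + (p : ℝ) := by
        push_cast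
        ring
      rw [mwChainAux, hc, if_pos (Finset.singleton_nonempty _), chooseMin_singleton, descList, hx,
        ih (by omega) (by omega) (by rw [if_neg (by omega)]) (Or.inr rfl)]

section Round

variable {a : ℝ} {p k : ℕ} {R : Multiset (Finset ℝ)}

theorem NearStair.staircase_add (hR : NearStair a p k R) :
    NearStair a p k (staircase a (p + 1) k + R) := by
  intro S hS
  rcases Multiset.mem_add.mp hS with h | h
  · obtain ⟨i, hi, rfl⟩ := mem_staircase.mp h
    exact ⟨i, hi, p, Or.inl rfl, rfl⟩
  · exact hR S h

theorem maxEnd_staircase_add (hk : 1 ≤ k) (hR : NearStair a p k R) :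
    maxEnd (staircase a (p + 1) k + R) = a + (k : ℝ) + (p : ℝ) := by
  apply maxEnd_eq_of_isGreatest
  · obtain ⟨j, rfl⟩ : ∃ j, k = j + 1 := ⟨k - 1, by omega⟩
    refine ⟨finsetSeg (a + (j : ℝ) + 1) (p + 1),
      Multiset.mem_add.mpr (Or.inl (mem_staircase.mpr ⟨j, by omega, rfl⟩)), ?_⟩
    rw [endg_finsetSeg_succ]
    push_cast
    ring
  · intro S hS
    obtain ⟨i, hi, q, hq, rfl⟩ := hR.staircase_add S hS
    rw [endg_finsetSeg_succ]
    have : (i : ℝ) + 1 + q ≤ k + p := by exact_mod_cast (by omega : i + 1 + q ≤ k + p)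
    linarith

theorem mwChain_staircase_add (hk : 1 ≤ k) (hR : NearStair a p k R) :
    mwChain (staircase a (p + 1) k + R) = descList a (p + 1) k := by
  rw [mwChain, maxEnd_staircase_add hk hR]
  refine hR.staircase_add.mwChainAux_eq (Multiset.le_add_right _ _) le_rfl ?_ (if_pos rfl).symm
  rw [Multiset.card_add, card_staircase]
  exact Nat.le_add_right _ _

theorem firstSeg_staircase_add (hk : 1 ≤ k) (hR : NearStair a p k R) :
    firstSeg (staircase a (p + 1) k + R) = finsetSeg (a + (p : ℝ) + 1) k := by
  have hlen : (descList a (p + 1) k).length = k := by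
    rw [← Multiset.coe_card, coe_descList, card_staircase]
  rw [firstSeg, mwChain_staircase_add hk hR, maxEnd_staircase_add hk hR, hlen, Nat.cast_sub hk]
  congr 1
  push_cast
  ring

theorem msMinus_staircase_add (hk : 1 ≤ k) (hR : NearStair a p k R) :
    msMinus (staircase a (p + 1) k + R) = (staircase a p k).filter (· ≠ ∅) + R := by
  rw [msMinus, mwChain_staircase_add hk hR, ← coe_descList, foldl_segMinus, coe_descList,
    map_segMinus_staircase]

theorem mwaAux_staircase_add (n : ℕ) (hk : 1 ≤ k) (hR : NearStair a p k R) :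
    mwaAux (n + 1) (staircase a (p + 1) k + R) =
      finsetSeg (a + (p : ℝ) + 1) k ::ₘ mwaAux n ((staircase a p k).filter (· ≠ ∅) + R) := by
  have hne : staircase a (p + 1) k + R ≠ 0 := by
    intro h
    have := congrArg Multiset.card h
    rw [Multiset.card_add, card_staircase, Multiset.card_zero] at this
    omega
  rw [mwaAux, if_neg hne, firstSeg_staircase_add hk hR, msMinus_staircase_add hk hR]

end Round

theorem filter_staircase_succ (a : ℝ) (p k : ℕ) :
    (staircase a (p + 1) k).filter (· ≠ ∅) = staircase a (p + 1) k := by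
  refine Multiset.filter_eq_self.mpr fun S hS => ?_
  obtain ⟨i, -, rfl⟩ := mem_staircase.mp hS
  exact finsetSeg_succ_ne_empty _ _

theorem nearStair_filter_staircase (a : ℝ) (p k : ℕ) :
    NearStair a p k ((staircase a p k).filter (· ≠ ∅)) := by
  intro S hS
  obtain ⟨hS, hne⟩ := Multiset.mem_filter.mp hS
  obtain ⟨i, hi, rfl⟩ := mem_staircase.mp hS
  cases p with
  | zero => exact absurd (finsetSeg_zero _) hne
  | succ q => exact ⟨i, hi, q, Or.inr rfl, rfl⟩

theorem nearStair_staircase (a : ℝ) (p k : ℕ) : NearStair a p k (staircase a (p + 1) k) := by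
  intro S hS
  obtain ⟨i, hi, rfl⟩ := mem_staircase.mp hS
  exact ⟨i, hi, p, Or.inl rfl, rfl⟩

theorem mwaAux_zero_right (n : ℕ) : mwaAux n 0 = 0 := by
  cases n <;> simp [mwaAux]

theorem mwaAux_double_staircase (a : ℝ) {k : ℕ} (hk : 1 ≤ k) (p n : ℕ) (hn : 2 * p ≤ n) :
    mwaAux n ((staircase a p k).filter (· ≠ ∅) + (staircase a p k).filter (· ≠ ∅)) =
      staircase a k p + staircase a k p := by
  induction p generalizing n with
  | zero =>
    have h : (staircase a 0 k).filter (· ≠ ∅) = 0 := by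
      refine Multiset.filter_eq_nil.mpr fun S hS => ?_
      obtain ⟨i, -, rfl⟩ := mem_staircase.mp hS
      simpa using finsetSeg_zero _
    rw [h, add_zero, mwaAux_zero_right]
    simp [staircase]
  | succ p ih =>
    obtain ⟨m, rfl⟩ : ∃ m, n = m + 1 + 1 := ⟨n - 2, by omega⟩
    rw [filter_staircase_succ, mwaAux_staircase_add _ hk (nearStair_staircase a p k),
      add_comm ((staircase a p k).filter (· ≠ ∅)),
      mwaAux_staircase_add _ hk (nearStair_filter_staircase a p k), ih m (by omega),
      staircase_succ, Multiset.cons_add, Multiset.add_cons]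

/-- `(M(a; l, k) ⊎ M(a; l, k))^# = M(a; k, l) ⊎ M(a; k, l)`. -/
theorem mwa_double_staircase (a : ℝ) (l k : ℕ) (hl : 1 ≤ l) (hk : 1 ≤ k) :
    mwa (staircase a l k + staircase a l k) = staircase a k l + staircase a k l := by
  obtain ⟨p, rfl⟩ : ∃ p, l = p + 1 := ⟨l - 1, by omega⟩
  have hcard : Multiset.card (suppM (staircase a (p + 1) k + staircase a (p + 1) k)) =
      k * (p + 1) + k * (p + 1) := by
    rw [card_suppM, Multiset.map_add, Multiset.sum_add]
    simp [staircase, card_finsetSeg]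
  have h := mwaAux_double_staircase a hk (p + 1) (k * (p + 1) + k * (p + 1)) (by nlinarith)
  rw [filter_staircase_succ] at h
  rw [mwa, hcard, h]
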